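/- Let A be a subset of the cube I^{n+1}, and let B be a countable base of nonempty open sets of I^{n+1}; then A has covering dimension dim A ≤ n if and only if no member of B is contained in A. -/

import Mathlib

open Set Metric

noncomputable section

/-- Covering dimension of a topological space is at most `n`: every open cover admits an
open refinement covering the space in which every point lies in at most `n+1` members. -/
def coveringDimLE (X : Type*) [TopologicalSpace X] (n : ℕ) : Prop :=
  ∀ U : Set (Set X), (∀ u ∈ U, IsOpen u) → ⋃₀ U = Set.univ →
    ∃ V : Set (Set X), (∀ v ∈ V, IsOpen v) ∧ ⋃₀ V = Set.univ ∧
      (∀ v ∈ V, ∃ u ∈ U, v ⊆ u) ∧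
      ∀ x : X, {v | v ∈ V ∧ x ∈ v}.Finite ∧ {v | v ∈ V ∧ x ∈ v}.ncard ≤ n + 1

/-- The cube `I^n` with the Euclidean metric. -/
def Cube (n : ℕ) := {x : EuclideanSpace ℝ (Fin n) // ∀ i, x i ∈ Set.Icc (0:ℝ) 1}

noncomputable instance (n : ℕ) : MetricSpace (Cube n) :=
  inferInstanceAs (MetricSpace {x : EuclideanSpace ℝ (Fin n) // ∀ i, x i ∈ Set.Icc (0:ℝ) 1})

/-- A perfect map: continuous, closed, with compact fibers. -/
def IsPerfectMap {X Y : Type*} [TopologicalSpace X] [TopologicalSpace Y] (f : X → Y) : Prop :=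
  Continuous f ∧ IsClosedMap f ∧ ∀ y : Y, IsCompact (f ⁻¹' {y})

/-- Openness in the source limitation (fine) topology on `C(X, K)`. -/
def SLOpen {X K : Type*} [TopologicalSpace X] [MetricSpace K] (U : Set C(X, K)) : Prop :=
  ∀ g ∈ U, ∃ α : C(X, ℝ), (∀ x, 0 < α x) ∧
    {h : C(X, K) | ∀ x, dist (h x) (g x) ≤ α x} ⊆ U

/-- Density in the source limitation (fine) topology on `C(X, K)`. -/
def SLDense {X K : Type*} [TopologicalSpace X] [MetricSpace K] (H : Set C(X, K)) : Prop :=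
  ∀ g : C(X, K), ∀ α : C(X, ℝ), (∀ x, 0 < α x) →
    ∃ h ∈ H, ∀ x, dist (h x) (g x) ≤ α x

/-- A `C`-space: for every sequence of open covers there is a sequence of pairwise disjoint
open families, the `k`-th refining the `k`-th cover, whose union covers the space. -/
def IsCSpace (Y : Type*) [TopologicalSpace Y] : Prop :=
  ∀ ω : ℕ → Set (Set Y), (∀ k, (∀ u ∈ ω k, IsOpen u) ∧ ⋃₀ ω k = Set.univ) →
    ∃ γ : ℕ → Set (Set Y),
      (∀ k, (∀ v ∈ γ k, IsOpen v) ∧ (∀ v ∈ γ k, ∃ u ∈ ω k, v ⊆ u) ∧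
        (γ k).Pairwise (Disjoint : Set Y → Set Y → Prop)) ∧
      ⋃₀ (⋃ k, γ k) = Set.univ


theorem aux_det_interp {E : Type*} [NormedAddCommGroup E] [NormedSpace ℝ E]
    [FiniteDimensional ℝ E] (v : ℕ → ℝ) (hv : Function.Injective v) :
    ∃ w : ℕ → ℝ, (∑ i ∈ Finset.range (Module.finrank ℝ E + 1), w i = 1) ∧
      ∀ M : E →L[ℝ] E, (1 + M).det =
        ∑ i ∈ Finset.range (Module.finrank ℝ E + 1), w i * (1 + v i • M).det := by
  classical
  set s := Finset.range (Module.finrank ℝ E + 1) with hs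
  refine ⟨fun i => (Lagrange.basis s v i).eval 1, ?_, ?_⟩
  · have h := Lagrange.sum_basis (s := s) (v := v) hv.injOn ⟨0, by simp [hs]⟩
    have h2 := congrArg (Polynomial.eval (1:ℝ)) h
    simpa [Polynomial.eval_finsetSum] using h2
  · intro M
    let b := Module.finBasis ℝ E
    let A : Matrix (Fin (Module.finrank ℝ E)) (Fin (Module.finrank ℝ E)) ℝ :=
      LinearMap.toMatrix b b (M : E →ₗ[ℝ] E)
    let p : Polynomial ℝ := Matrix.det
      ((Polynomial.X : Polynomial ℝ) • A.map Polynomial.C + (1 : Matrix _ _ ℝ).map Polynomial.C)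
    have hp : ∀ t : ℝ, p.eval t = (1 + t • M).det := by
      intro t
      have h1 : (1 + t • M).det = Matrix.det (1 + t • A) := by
        rw [ContinuousLinearMap.det, ← LinearMap.det_toMatrix b]
        congr 1
        have : ((1 + t • M : E →L[ℝ] E) : E →ₗ[ℝ] E) = LinearMap.id + t • (M : E →ₗ[ℝ] E) := rfl
        rw [this, map_add, map_smul, LinearMap.toMatrix_id]
      rw [h1]
      change (Polynomial.evalRingHom t) p = _
      rw [RingHom.map_det]
      congr 1
      ext i j
      by_cases hij : i = j <;>
      (simp [hij, add_comm]; exact mul_comm _ _)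
    have hdeg : p.degree < s.card := by
      have := Polynomial.natDegree_det_X_add_C_le A 1
      rw [Fintype.card_fin] at this
      refine lt_of_le_of_lt Polynomial.degree_le_natDegree ?_
      rw [hs, Finset.card_range]
      exact_mod_cast Nat.lt_succ_of_le this
    have := congrArg (Polynomial.eval (1:ℝ)) (Lagrange.eq_interpolate hv.injOn hdeg)
    rw [hp, one_smul] at this
    rw [this, Lagrange.interpolate_apply, Polynomial.eval_finsetSum]
    refine Finset.sum_congr rfl fun i _ => ?_
    rw [Polynomial.eval_mul, Polynomial.eval_C, hp, mul_comm]

theorem aux_surj {E : Type*} [NormedAddCommGroup E] [CompleteSpace E]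
    (g : E → E) (K : NNReal) (hK : K < 1) (hg : LipschitzWith K g) :
    Function.Bijective (fun x => x + g x) := by
  constructor
  · intro x y h
    have h1 : x - y = g y - g x := by
      have : x + g x = y + g y := h
      rw [sub_eq_sub_iff_add_eq_add, this, add_comm]
    have h2 := hg.dist_le_mul x y
    rw [dist_eq_norm, dist_eq_norm, ← neg_sub (g y), norm_neg, ← h1] at h2
    have hK' : (K : ℝ) < 1 := by exact_mod_cast hK
    have : ‖x - y‖ = 0 := by nlinarith [norm_nonneg (x - y)]
    exact sub_eq_zero.mp (norm_eq_zero.mp this)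
  · intro y
    have hc : ContractingWith K (fun x => y - g x) := by
      refine ⟨hK, ?_⟩
      refine LipschitzWith.of_dist_le_mul fun a b => ?_
      rw [dist_sub_left]
      exact hg.dist_le_mul a b
    refine ⟨hc.fixedPoint, ?_⟩
    have := hc.fixedPoint_isFixedPt
    unfold Function.IsFixedPt at this
    simp only at this ⊢
    nth_rewrite 1 [← this]
    abel

theorem aux_degree {E : Type*} [NormedAddCommGroup E] [NormedSpace ℝ E]
    [FiniteDimensional ℝ E] [MeasurableSpace E] [BorelSpace E]
    (μ : MeasureTheory.Measure E) [μ.IsAddHaarMeasure] (g : E → E) (K : NNReal)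
    (hg : LipschitzWith K g) (B : Set E) (hB : IsOpen B) (hμ : μ B ≠ ⊤)
    (hz : ∀ x, x ∉ B → g x = 0) (hd : ∀ x ∈ B, DifferentiableAt ℝ g x) :
    ∫ x in B, (1 + fderiv ℝ g x).det ∂μ = μ.real B := by
  have : CompleteSpace E := FiniteDimensional.complete ℝ E
  obtain ⟨δ, hδ, hδ'⟩ : ∃ δ > 0, ∀ M : E →L[ℝ] E, ‖M‖ < δ → 0 < (1 + M).det := by
    have hc : Continuous fun M : E →L[ℝ] E => (1 + M).det :=
      ContinuousLinearMap.continuous_det.comp (continuous_const.add continuous_id)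
    have h1 : (0:ℝ) < (1 + (0 : E →L[ℝ] E)).det := by
      rw [add_zero, ContinuousLinearMap.det]
      have : ((1 : E →L[ℝ] E) : E →ₗ[ℝ] E) = LinearMap.id := rfl
      rw [this, LinearMap.det_id]; norm_num
    have := (hc.continuousAt (x := 0)).eventually_const_lt h1
    obtain ⟨δ, hδ, h⟩ := Metric.eventually_nhds_iff.mp this
    exact ⟨δ, hδ, fun M hM => h (by simpa using hM)⟩
  have hK0 : (0:ℝ) ≤ K := K.2
  let τ : ℝ := min δ 1 / (2 * (K + 1))
  have hτ : 0 < τ := by positivity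
  have hτK : τ * K < min δ 1 := by
    have : τ * (2 * (K + 1)) = min δ 1 := by
      simp only [τ]; field_simp
    nlinarith
  -- small parameter
  have key : ∀ t : ℝ, 0 < t → t ≤ τ →
      MeasureTheory.IntegrableOn (fun x => (1 + t • fderiv ℝ g x).det) B μ ∧
      ∫ x in B, (1 + t • fderiv ℝ g x).det ∂μ = μ.real B := by
    intro t ht htτ
    have htK : t * K < min δ 1 := lt_of_le_of_lt (by gcongr) hτK
    have hlip : LipschitzWith (Real.toNNReal t * K) (fun x => t • g x) := by
      refine LipschitzWith.of_dist_le_mul fun a b => ?_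
      rw [dist_smul₀, Real.norm_of_nonneg ht.le, NNReal.coe_mul, Real.coe_toNNReal _ ht.le, mul_assoc]
      exact mul_le_mul_of_nonneg_left (hg.dist_le_mul a b) ht.le
    have hbij := aux_surj (fun x => t • g x) _ (by
      have := htK.trans_le (min_le_right _ _)
      rw [← NNReal.coe_lt_coe, NNReal.coe_mul, Real.coe_toNNReal _ ht.le]
      exact this) hlip
    have himg : (fun x => x + t • g x) '' B = B := by
      apply Subset.antisymm
      · rintro _ ⟨x, hx, rfl⟩
        by_contra hn
        have h1 : (fun x => x + t • g x) ((fun x => x + t • g x) x) = (fun x => x + t • g x) x := by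
          simp only
          simp only at hn
          rw [hz _ hn, smul_zero, add_zero]
        have := hbij.1 h1
        rw [this] at hn
        exact hn hx
      · intro y hy
        obtain ⟨x, hx⟩ := hbij.2 y
        refine ⟨x, ?_, hx⟩
        by_contra hn
        simp only [hz x hn, smul_zero, add_zero] at hx
        exact hn (hx ▸ hy)
    have hder : ∀ x ∈ B, HasFDerivWithinAt (fun x => x + t • g x) (1 + t • fderiv ℝ g x) B x := by
      intro x hx
      have := (hasFDerivAt_id x).add ((hd x hx).hasFDerivAt.const_smul t)
      exact this.hasFDerivWithinAt
    have hpos : ∀ x, 0 < (1 + t • fderiv ℝ g x).det := by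
      intro x
      apply hδ'
      rw [norm_smul, Real.norm_of_nonneg ht.le]
      refine lt_of_le_of_lt ?_ (htK.trans_le (min_le_left _ _))
      gcongr
      exact norm_fderiv_le_of_lipschitz ℝ hg
    have hI := MeasureTheory.integral_image_eq_integral_abs_det_fderiv_smul μ hB.measurableSet hder
      hbij.1.injOn (fun _ => (1:ℝ))
    have hJ := (MeasureTheory.integrableOn_image_iff_integrableOn_abs_det_fderiv_smul μ
      hB.measurableSet hder hbij.1.injOn (fun _ => (1:ℝ)))
    rw [himg] at hI hJ
    simp only [abs_of_pos (hpos _), smul_eq_mul, mul_one] at hI hJ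
    refine ⟨hJ.mp (by simp [hμ, lt_top_iff_ne_top]), ?_⟩
    rw [← hI]; simp
  let v : ℕ → ℝ := fun i => τ / (i + 1)
  have hv0 : ∀ i, 0 < v i := fun i => by positivity
  have hvτ : ∀ i, v i ≤ τ := fun i => by
    apply div_le_self hτ.le
    have : (0:ℝ) ≤ i := by positivity
    linarith
  have hvinj : Function.Injective v := by
    intro i j h
    simp only [v] at h
    rw [div_eq_div_iff (by positivity) (by positivity)] at h
    have := mul_left_cancel₀ hτ.ne' h
    have : (j:ℝ) = i := by linarith
    exact_mod_cast this.symm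
  obtain ⟨w, hw1, hw⟩ := aux_det_interp (E := E) v hvinj
  have hfun : (fun x => (1 + fderiv ℝ g x).det) = fun x =>
      ∑ i ∈ Finset.range (Module.finrank ℝ E + 1), w i * (1 + v i • fderiv ℝ g x).det :=
    funext fun x => hw _
  rw [hfun]
  rw [MeasureTheory.integral_finsetSum]
  · simp_rw [MeasureTheory.integral_const_mul, (key _ (hv0 _) (hvτ _)).2]
    rw [← Finset.sum_mul, hw1, one_mul]
  · intro i _
    exact (key _ (hv0 i) (hvτ i)).1.const_mul _

theorem aux_noret {E : Type*} [NormedAddCommGroup E] [InnerProductSpace ℝ E]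
    [FiniteDimensional ℝ E] [MeasurableSpace E] [BorelSpace E]
    (y : E) (R : ℝ) (hR : 0 < R) (Φ : E → E) (hΦ : ContDiff ℝ 1 Φ)
    (hid : ∀ x, dist x y = R → Φ x = x) (hne : ∀ x, dist x y ≤ R → Φ x ≠ y) : False := by
  classical
  let Ψ : E → E := fun x => y + (R / ‖Φ x - y‖) • (Φ x - y)
  have hΨd : ∀ x, dist x y ≤ R → ContDiffAt ℝ 1 Ψ x := by
    intro x hx
    have h0 : Φ x - y ≠ 0 := sub_ne_zero.mpr (hne x hx)
    have h1 : ContDiffAt ℝ 1 (fun x => Φ x - y) x := hΦ.contDiffAt.sub contDiffAt_const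
    refine contDiffAt_const.add (ContDiffAt.smul (contDiffAt_const.div (h1.norm ℝ h0) ?_) h1)
    exact norm_ne_zero_iff.mpr h0
  have hΨn : ∀ x, Φ x ≠ y → ‖Ψ x - y‖ = R := by
    intro x hx
    have h0 : ‖Φ x - y‖ ≠ 0 := norm_ne_zero_iff.mpr (sub_ne_zero.mpr hx)
    simp only [Ψ, add_sub_cancel_left, norm_smul, norm_div, norm_norm, Real.norm_of_nonneg hR.le]
    field_simp
  have hΨid : ∀ x, dist x y = R → Ψ x = x := by
    intro x hx
    simp only [Ψ, hid x hx]
    rw [← dist_eq_norm, hx, div_self hR.ne', one_smul, add_sub_cancel]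
  let g : E → E := fun x => if dist x y ≤ R then Ψ x - x else 0
  have hgin : ∀ x, dist x y ≤ R → g x = Ψ x - x := fun x hx => if_pos hx
  have hgout : ∀ x, R ≤ dist x y → g x = 0 := by
    intro x hx
    rcases hx.eq_or_lt with h | h
    · rw [hgin x h.ge, hΨid x h.symm, sub_self]
    · exact if_neg (not_le.mpr h)
  have hC : ContDiffOn ℝ 1 (fun x => Ψ x - x) (closedBall y R) := by
    intro x hx
    exact ((hΨd x hx).sub contDiffAt_id).contDiffWithinAt
  obtain ⟨K, hK⟩ := hC.exists_lipschitzOnWith one_ne_zero (convex_closedBall y R)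
    (isCompact_closedBall y R)
  have cross : ∀ x z, dist x y ≤ R → R ≤ dist z y → dist (g x) (g z) ≤ K * dist x z := by
    intro x z hx hz
    have hcont : ContinuousOn (fun s : ℝ => dist (x + s • (z - x)) y) (Icc 0 1) := by fun_prop
    have := intermediate_value_Icc (zero_le_one) hcont
    obtain ⟨s, hs, hs'⟩ := this (show R ∈ _ by simpa using ⟨hx, hz⟩)
    simp only at hs'
    have h1 := hK.dist_le_mul x hx (x + s • (z - x)) hs'.le
    rw [← hgin x hx, ← hgin _ hs'.le, hgout _ hs'.ge] at h1
    rw [hgout z hz]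
    refine h1.trans ?_
    gcongr
    rw [dist_self_add_right, norm_smul, Real.norm_of_nonneg hs.1, dist_comm, dist_eq_norm]
    exact mul_le_of_le_one_left (norm_nonneg _) hs.2
  have hgL : LipschitzWith K g := by
    refine LipschitzWith.of_dist_le_mul fun a b => ?_
    rcases le_total (dist a y) R with ha | ha <;> rcases le_total (dist b y) R with hb | hb
    · rw [hgin a ha, hgin b hb]
      exact hK.dist_le_mul a ha b hb
    · exact cross a b ha hb
    · rw [dist_comm, dist_comm a]
      exact cross b a hb ha
    · rw [hgout a ha, hgout b hb, dist_self]; positivity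
  have hev : ∀ x ∈ ball y R, g =ᶠ[nhds x] fun x => Ψ x - x := by
    intro x hx
    filter_upwards [isOpen_ball.mem_nhds hx] with z hz
    exact hgin z (le_of_lt hz)
  have hgd : ∀ x ∈ ball y R, HasFDerivAt g (fderiv ℝ Ψ x - ContinuousLinearMap.id ℝ E) x := by
    intro x hx
    have h1 : DifferentiableAt ℝ Ψ x := (hΨd x (le_of_lt hx)).differentiableAt one_ne_zero
    exact (h1.hasFDerivAt.sub (hasFDerivAt_id x)).congr_of_eventuallyEq (hev x hx)
  have hdeg := aux_degree (MeasureTheory.volume : MeasureTheory.Measure E) g K hgL (ball y R) isOpen_ball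
    MeasureTheory.measure_ball_lt_top.ne
    (fun x hx => hgout x (not_lt.mp hx)) (fun x hx => (hgd x hx).differentiableAt)
  have hdet : ∀ x ∈ ball y R, (1 + fderiv ℝ g x).det = 0 := by
    intro x hx
    have h1 : DifferentiableAt ℝ Ψ x := (hΨd x (le_of_lt hx)).differentiableAt one_ne_zero
    have h2 : 1 + fderiv ℝ g x = fderiv ℝ Ψ x := by
      rw [(hgd x hx).fderiv]
      change ContinuousLinearMap.id ℝ E + _ = _
      abel
    rw [h2]
    by_contra hnz
    let e := LinearMap.equivOfDetNeZero (fderiv ℝ Ψ x : E →ₗ[ℝ] E) hnz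
    obtain ⟨v, hv⟩ := e.surjective (Ψ x - y)
    have hv' : fderiv ℝ Ψ x v = Ψ x - y := hv
    have h3 : HasFDerivAt (fun z => Ψ z - y) (fderiv ℝ Ψ x) x := h1.hasFDerivAt.sub_const y
    have h4 := h3.norm_sq
    have h5 : (fun z => ‖Ψ z - y‖ ^ 2) =ᶠ[nhds x] fun _ => R ^ 2 := by
      filter_upwards [isOpen_ball.mem_nhds hx] with z hz
      rw [hΨn z (hne z (le_of_lt hz))]
    have h6 := h4.unique ((hasFDerivAt_const (R^2) x).congr_of_eventuallyEq h5)
    have h7 := congrArg (fun L : E →L[ℝ] ℝ => L v) h6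
    have h8 := hΨn x (hne x (le_of_lt hx))
    simp [hv'] at h7
    rw [← inner_sub_left, real_inner_self_eq_norm_sq, h8] at h7
    exact hR.ne' (pow_eq_zero_iff two_ne_zero |>.mp h7)
  rw [MeasureTheory.setIntegral_congr_fun measurableSet_ball (fun x hx => hdet x hx)] at hdeg
  have hp : 0 < MeasureTheory.volume.real (ball y R) :=
    ENNReal.toReal_pos (Metric.measure_ball_pos _ y hR).ne' MeasureTheory.measure_ball_lt_top.ne
  simp at hdeg
  linarith

theorem aux_span {E : Type*} [NormedAddCommGroup E] [InnerProductSpace ℝ E] [FiniteDimensional ℝ E]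
    (n : ℕ) (hE : Module.finrank ℝ E = n + 1) {ι : Type*} (p : ι → E) (J : Finset ι)
    (hJ : J.card ≤ n + 1) : affineSpan ℝ (p '' (J : Set ι)) ≠ ⊤ := by
  classical
  intro h
  rcases Nat.eq_zero_or_pos J.card with h0 | h0
  · rw [Finset.card_eq_zero] at h0
    subst h0
    simp at h
  · obtain ⟨m, hm⟩ : ∃ m, J.card = m + 1 := ⟨J.card - 1, by omega⟩
    have h1 := finrank_vectorSpan_image_finset_le ℝ p J hm
    have h2 := congrArg AffineSubspace.direction h
    rw [direction_affineSpan, AffineSubspace.direction_top] at h2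
    rw [Finset.coe_image, h2, finrank_top, hE] at h1
    omega

open scoped Manifold ContDiff in
theorem aux_cov {E : Type*} [NormedAddCommGroup E] [InnerProductSpace ℝ E] [FiniteDimensional ℝ E]
    [MeasurableSpace E] [BorelSpace E]
    (n : ℕ) (hE : Module.finrank ℝ E = n + 1) (X : Type*) [TopologicalSpace X] (hX : coveringDimLE X n)
    (f : X → E) (hf : Continuous f)
    (O : Set (E)) (hO : IsOpen O) (hne : O.Nonempty)
    (g : O → X) (hg : Continuous g) (hfg : ∀ x : O, f (g x) = x) : False := by
  classical
  obtain ⟨c, hc⟩ := hne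
  obtain ⟨r, hr, hrO⟩ := Metric.isOpen_iff.mp hO c hc
  obtain ⟨R, hR, hRr⟩ : ∃ R : ℝ, 0 < R ∧ 2 * R < r := ⟨r / 4, by positivity, by linarith⟩
  set s : Set E := closedBall c (2 * R) with hs
  have hsO : s ⊆ O := (closedBall_subset_ball hRr).trans hrO
  set ε := R / 4 with hε
  have hεpos : 0 < ε := by positivity
  obtain ⟨V, hVo, hVc, hVr, hVord⟩ := hX (range fun p : E => f ⁻¹' (ball p ε))
    (by rintro _ ⟨p, rfl⟩; exact isOpen_ball.preimage hf)
    (by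
      refine eq_univ_of_forall fun x => ⟨f ⁻¹' (ball (f x) ε), ⟨f x, rfl⟩, ?_⟩
      exact mem_ball_self hεpos)
  have hp : ∀ v : V, ∃ p : E, (v : Set X) ⊆ f ⁻¹' (ball p ε) := by
    rintro ⟨v, hv⟩
    obtain ⟨_, ⟨p, rfl⟩, h⟩ := hVr v hv
    exact ⟨p, h⟩
  choose p hp using hp
  let W : V → Set E := fun v => Subtype.val '' (g ⁻¹' (v : Set X))
  have hWo : ∀ v, IsOpen (W v) := fun v =>
    hO.isOpenMap_subtype_val _ ((hVo v v.2).preimage hg)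
  have hWc : s ⊆ ⋃ v, W v := by
    intro x hx
    have : g ⟨x, hsO hx⟩ ∈ ⋃₀ V := by rw [hVc]; trivial
    obtain ⟨v, hv, hgv⟩ := this
    exact mem_iUnion.mpr ⟨⟨v, hv⟩, ⟨x, hsO hx⟩, hgv, rfl⟩
  obtain ⟨T, hT⟩ := (isCompact_closedBall c (2 * R)).elim_finite_subcover W hWo hWc
  obtain ⟨lam, hlam⟩ := SmoothPartitionOfUnity.exists_isSubordinate 𝓘(ℝ, E)
    (isClosed_closedBall : IsClosed s) (fun i : T => W i) (fun i => hWo i)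
    (by
      intro x hx
      obtain ⟨i, hi, hxi⟩ := mem_iUnion₂.mp (hT hx)
      exact mem_iUnion.mpr ⟨⟨i, hi⟩, hxi⟩)
  have hsum : ∀ x ∈ s, ∑ i, lam i x = 1 := by
    intro x hx
    rw [← finsum_eq_sum_of_fintype]
    exact lam.sum_eq_one hx
  have hsupp : ∀ i x, lam i x ≠ 0 → x ∈ W i := by
    intro i x h
    exact hlam i (subset_tsupport _ h)
  have hWp : ∀ v x, x ∈ W v → dist x (p v) < ε := by
    rintro v _ ⟨x, hx, rfl⟩
    have := hp v hx
    rwa [mem_preimage, hfg] at this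
  let Φ₀ : E → E := fun x => ∑ i, lam i x • p i
  have hΦ₀ : ContDiff ℝ 1 Φ₀ := by
    refine ContDiff.sum fun i _ => ?_
    have h1 : ContDiff ℝ ∞ (lam i) := (lam i).contMDiff.contDiff
    exact (h1.of_le (by exact_mod_cast le_top)).smul contDiff_const
  have hclose : ∀ x ∈ s, dist (Φ₀ x) x ≤ ε := by
    intro x hx
    have : Φ₀ x ∈ closedBall x ε := by
      have := (convex_closedBall x ε)
      -- only use indices with nonzero weight
      have h2 : Φ₀ x = ∑ i ∈ Finset.univ.filter (fun i => lam i x ≠ 0), lam i x • p i := by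
        rw [Finset.sum_filter_of_ne]
        intro i _ h h0
        exact h (by rw [h0, zero_smul])
      rw [h2]
      refine (convex_closedBall x ε).sum_mem (fun i _ => lam.nonneg i x) ?_ ?_
      · rw [Finset.sum_filter_ne_zero, hsum x hx]
      · intro i hi
        rw [mem_closedBall, dist_comm]
        exact (hWp _ _ (hsupp i x (Finset.mem_filter.mp hi).2)).le
    exact this
  let N : Set E := ⋃ J : {J : Finset T // J.card ≤ n + 1},
    (affineSpan ℝ ((fun i : T => p i) '' (J.1 : Set T)) : Set E)
  have hN : MeasureTheory.volume N = 0 := by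
    refine MeasureTheory.measure_iUnion_null fun J => ?_
    exact MeasureTheory.Measure.addHaar_affineSubspace _ _ (aux_span n hE _ _ J.2)
  have himg : ∀ x ∈ s, Φ₀ x ∈ N := by
    intro x hx
    let J : Finset T := Finset.univ.filter (fun i => lam i x ≠ 0)
    have hJ : J.card ≤ n + 1 := by
      obtain ⟨hfin, hcard⟩ := hVord (g ⟨x, hsO hx⟩)
      refine le_trans ?_ hcard
      have hinj : Function.Injective (fun i : T => ((i : V) : Set X)) :=
        Subtype.val_injective.comp Subtype.val_injective
      rw [← Finset.card_image_of_injective J hinj, ← Set.ncard_coe_finset]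
      refine Set.ncard_le_ncard ?_ hfin
      intro v hv
      obtain ⟨i, hi, rfl⟩ := Finset.mem_image.mp (Finset.mem_coe.mp hv)
      refine ⟨i.1.2, ?_⟩
      obtain ⟨z, hz, hzx⟩ := hsupp i x (Finset.mem_filter.mp hi).2
      have : z = ⟨x, hsO hx⟩ := Subtype.ext hzx
      rw [← this]; exact hz
    refine mem_iUnion.mpr ⟨⟨J, hJ⟩, ?_⟩
    apply convexHull_subset_affineSpan
    have h2 : Φ₀ x = ∑ i ∈ J, lam i x • p i := by
      rw [Finset.sum_filter_of_ne]
      intro i _ h h0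
      exact h (by rw [h0, zero_smul])
    rw [h2]
    refine (convex_convexHull ℝ _).sum_mem (fun i _ => lam.nonneg i x) ?_ ?_
    · rw [Finset.sum_filter_ne_zero, hsum x hx]
    · intro i hi
      exact subset_convexHull _ _ ⟨i, hi, rfl⟩
  obtain ⟨y, hyc, hyN⟩ : ∃ y ∈ ball c ε, y ∉ N := by
    by_contra hcon
    push Not at hcon
    have h1 := MeasureTheory.measure_mono_null hcon hN
    exact (Metric.measure_ball_pos _ c hεpos).ne' h1
  let χ : ContDiffBump y := ⟨R / 2, 3 * R / 4, by positivity, by linarith⟩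
  have hys : ∀ x, dist x y ≤ R → x ∈ s := by
    intro x hx
    have := dist_triangle x y c
    rw [mem_ball] at hyc
    rw [hs, mem_closedBall]; linarith
  refine aux_noret y R hR (fun x => x + χ x • (Φ₀ x - x))
    (contDiff_id.add (χ.contDiff.smul (hΦ₀.sub contDiff_id))) ?_ ?_
  · intro x hx
    have : χ x = 0 := χ.zero_of_le_dist (by change 3 * R / 4 ≤ _; linarith)
    simp [this]
  · intro x hx heq
    rcases le_or_gt (dist x y) (R / 2) with h | h
    · have : χ x = 1 := χ.one_of_mem_closedBall h
      rw [this, one_smul, add_sub_cancel] at heq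
      exact hyN (heq ▸ himg x (hys x hx))
    · have h1 : dist x y ≤ ε := by
        rw [← heq, dist_self_add_right, norm_smul, Real.norm_of_nonneg χ.nonneg, ← dist_eq_norm]
        exact (mul_le_of_le_one_left dist_nonneg χ.le_one).trans (hclose x (hys x hx))
      linarith

theorem aux_step {E : Type*} [NormedAddCommGroup E] [NormedSpace ℝ E] [CompleteSpace E]
    (D : Set E) (hD : Dense D) (φ : E → E)
    (hφ : ∀ x y, dist (φ x) (φ y) ≤ 1 / 2 * dist x y) (F : Set E) (hF : F.Finite)
    (q : E) (hq : ∀ d ∈ F, d + φ d ≠ q) (ε : ℝ) (hε : 0 < ε) :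
    ∃ d ∈ D, ∃ ψ : E → E, (∀ x y, dist (ψ x) (ψ y) ≤ ε * dist x y) ∧ (∀ x, ‖ψ x‖ ≤ ε) ∧
      (∀ x ∈ F, ψ x = 0) ∧ d + φ d + ψ d = q := by
  have hL : LipschitzWith (1/2) φ := LipschitzWith.of_dist_le_mul (by
    intro x y; simpa using hφ x y)
  obtain ⟨x0, hx0⟩ := (aux_surj φ (1/2) (by
    rw [← NNReal.coe_lt_coe]; push_cast; norm_num) hL).2 q
  simp only at hx0
  have hx0F : x0 ∈ Fᶜ := fun h => hq x0 h hx0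
  obtain ⟨r, hr, hrF⟩ := Metric.isOpen_iff.mp hF.isClosed.isOpen_compl x0 hx0F
  set δ := min (r / 2) (min (ε * r / 4) (ε / 2)) with hδ
  have hδ0 : 0 < δ := by positivity
  have hδ1 : δ ≤ r / 2 := min_le_left _ _
  have hδ2 : δ ≤ ε * r / 4 := (min_le_right _ _).trans (min_le_left _ _)
  have hδ3 : δ ≤ ε / 2 := (min_le_right _ _).trans (min_le_right _ _)
  obtain ⟨d, hdD, hd⟩ := hD.exists_dist_lt x0 hδ0
  set w := q - (d + φ d) with hw
  have hwn : ‖w‖ ≤ 2 * δ := by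
    have h1 : w = (x0 - d) + (φ x0 - φ d) := by rw [hw, ← hx0]; abel
    have h2 := hφ x0 d
    rw [h1]
    refine (norm_add_le _ _).trans ?_
    rw [← dist_eq_norm, ← dist_eq_norm]
    linarith [dist_nonneg (x := x0) (y := d)]
  refine ⟨d, hdD, fun x => max 0 (1 - dist x d * (2 / r)) • w, ?_, ?_, ?_, ?_⟩
  · intro x y
    rw [dist_eq_norm, ← sub_smul, norm_smul, Real.norm_eq_abs]
    have h1 : |max 0 (1 - dist x d * (2 / r)) - max 0 (1 - dist y d * (2 / r))| ≤
        dist x y * (2 / r) := by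
      have h0 : |max 0 (1 - dist x d * (2 / r)) - max 0 (1 - dist y d * (2 / r))| ≤
          |(1 - dist x d * (2 / r)) - (1 - dist y d * (2 / r))| := by
        rw [max_comm 0, max_comm 0]; exact abs_max_sub_max_le_abs _ _ _
      refine h0.trans ?_
      · have : (1 - dist x d * (2 / r)) - (1 - dist y d * (2 / r)) =
          (dist y d - dist x d) * (2 / r) := by ring
        rw [this, abs_mul, abs_of_pos (show 0 < 2 / r by positivity)]
        gcongr
        rw [abs_sub_comm]
        exact abs_dist_sub_le x y d
    calc _ ≤ dist x y * (2 / r) * (2 * δ) := by gcongr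
      _ ≤ dist x y * (2 / r) * (2 * (ε * r / 4)) := by gcongr
      _ = ε * dist x y := by field_simp; ring
  · intro x
    rw [norm_smul, Real.norm_of_nonneg (le_max_left _ _)]
    have h1 : max 0 (1 - dist x d * (2 / r)) ≤ 1 := by
      apply max_le zero_le_one
      have : 0 ≤ dist x d * (2 / r) := by positivity
      linarith
    calc _ ≤ 1 * (2 * δ) := by gcongr
      _ ≤ ε := by linarith
  · intro x hx
    have h1 : r ≤ dist x x0 := by
      by_contra h
      exact hrF (mem_ball.mpr (not_le.mp h)) hx
    have h2 : r / 2 ≤ dist x d := by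
      have := dist_triangle x d x0
      rw [dist_comm d x0] at this
      linarith
    have h3 : max 0 (1 - dist x d * (2 / r)) = 0 := by
      apply max_eq_left
      have : r / 2 * (2 / r) = 1 := by field_simp
      have h4 : r / 2 * (2 / r) ≤ dist x d * (2 / r) := by gcongr
      linarith
    simp only [h3, zero_smul]
  · simp [hw]

theorem aux_homeo {E : Type*} [NormedAddCommGroup E] [NormedSpace ℝ E] [CompleteSpace E]
    (D : Set E) (hD : Dense D) (q : ℕ → E) :
    ∃ φ : E → E, (∀ x y, dist (φ x) (φ y) ≤ 1 / 2 * dist x y) ∧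
      ∀ k, ∃ d ∈ D, d + φ d = q k := by
  classical
  let P : ℕ → (E → E) × Set E → Prop := fun k s =>
    s.2.Finite ∧ s.2 ⊆ D ∧ ∀ x y, dist (s.1 x) (s.1 y) ≤ (1 / 2 - (1/2)^(k+1)) * dist x y
  let R : ℕ → (E → E) × Set E → (E → E) × Set E → Prop := fun k s s' =>
    s.2 ⊆ s'.2 ∧ (∀ x ∈ s.2, s'.1 x = s.1 x) ∧ (∀ x, dist (s.1 x) (s'.1 x) ≤ 1 * (1/2)^k) ∧
      ∃ d ∈ s'.2, d + s'.1 d = q k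
  have step : ∀ k s, P k s → ∃ s', P (k+1) s' ∧ R k s s' := by
    rintro k ⟨φ, F⟩ ⟨hF, hFD, hφ⟩
    simp only at hF hFD hφ
    have hpw : (0:ℝ) < (1/2)^(k+1) := by positivity
    have hp2 : ((1:ℝ)/2)^(k+1+1) = (1/2)^(k+1) / 2 := by rw [pow_succ]; ring
    have hp3 : ((1:ℝ)/2)^(k+1) = (1/2)^k / 2 := by rw [pow_succ]; ring
    by_cases hq : ∀ d ∈ F, d + φ d ≠ q k
    · obtain ⟨d, hd, ψ, h1, h2, h3, h4⟩ := aux_step D hD φ (fun x y => (hφ x y).trans (by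
        gcongr; linarith)) F hF (q k) hq ((1/2)^(k+1+1)) (by positivity)
      refine ⟨(fun x => φ x + ψ x, insert d F), ⟨hF.insert d, insert_subset hd hFD, ?_⟩,
        subset_insert _ _, ?_, ?_, d, mem_insert _ _, ?_⟩
      · intro x y
        refine (dist_add_add_le _ _ _ _).trans ?_
        have := hφ x y
        have := h1 x y
        rw [hp2] at *
        linarith
      · intro x hx
        simp [h3 x hx]
      · intro x
        simp only [dist_self_add_right]
        refine (h2 x).trans ?_
        linarith
      · rw [← h4]; simp only; abel
    · push Not at hq
      obtain ⟨d, hd, hdq⟩ := hq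
      refine ⟨(φ, F), ⟨hF, hFD, fun x y => (hφ x y).trans ?_⟩, Subset.rfl, fun _ _ => rfl, ?_,
        d, hd, hdq⟩
      · refine mul_le_mul_of_nonneg_right ?_ dist_nonneg
        linarith
      · intro x
        simp only [dist_self]; positivity
  choose! next hnext using step
  let S : ℕ → (E → E) × Set E := fun k => Nat.rec (fun _ => 0, ∅) (fun k s => next k s) k
  have hS : ∀ k, S (k+1) = next k (S k) := fun k => rfl
  have hP : ∀ k, P k (S k) := by
    intro k
    induction k with
    | zero => exact ⟨finite_empty, empty_subset _, fun x y => by simp [S]⟩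
    | succ k ih => rw [hS]; exact (hnext k _ ih).1
  have hR : ∀ k, R k (S k) (S (k+1)) := fun k => by rw [hS]; exact (hnext k _ (hP k)).2
  have hcau : ∀ x, CauchySeq fun k => (S k).1 x := fun x =>
    cauchySeq_of_le_geometric (1/2) 1 (by norm_num) fun k => (hR k).2.2.1 x
  choose φ hφ using fun x => cauchySeq_tendsto_of_complete (hcau x)
  refine ⟨φ, ?_, ?_⟩
  · intro x y
    refine le_of_tendsto ((hφ x).dist (hφ y)) (Filter.Eventually.of_forall fun k => ?_)
    refine ((hP k).2.2 x y).trans ?_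
    gcongr
    have : (0:ℝ) < (1/2)^(k+1) := by positivity
    linarith
  · intro k
    obtain ⟨d, hd, hdq⟩ := (hR k).2.2.2
    refine ⟨d, (hP (k+1)).2.1 hd, ?_⟩
    have hconst : ∀ m, d ∈ (S (k+1+m)).2 ∧ (S (k+1+m)).1 d = (S (k+1)).1 d := by
      intro m
      induction m with
      | zero => exact ⟨hd, rfl⟩
      | succ m ih =>
        exact ⟨(hR (k+1+m)).1 ih.1, ((hR (k+1+m)).2.1 d ih.1).trans ih.2⟩
    have hlim : Filter.Tendsto (fun j => (S j).1 d) Filter.atTop (nhds ((S (k+1)).1 d)) := by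
      refine tendsto_const_nhds.congr' ?_
      filter_upwards [Filter.eventually_ge_atTop (k+1)] with j hj
      obtain ⟨m, rfl⟩ := Nat.exists_eq_add_of_le hj
      exact (hconst m).2.symm
    rw [tendsto_nhds_unique (hφ d) hlim, hdq]

theorem aux_swell {X : Type*} [MetricSpace X] (F u : ℕ → Set X) (hu : ∀ j, IsOpen (u j))
    (hFu : ∀ j, F j ⊆ u j) (hcov : ∀ x, ∃ j, x ∈ F j)
    (hO : ∀ x, ∃ O ∈ nhds x, ∀ j, (O ∩ F j).Nonempty → x ∈ F j) (m : ℕ)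
    (hord : ∀ x, ∀ T : Finset ℕ, (∀ j ∈ T, x ∈ F j) → T.card ≤ m) :
    ∃ v : ℕ → Set X, (∀ j, IsOpen (v j)) ∧ (∀ j, v j ⊆ u j) ∧ (∀ x, ∃ j, x ∈ v j) ∧
      ∀ x, ∀ T : Finset ℕ, (∀ j ∈ T, x ∈ v j) → T.card ≤ m := by
  have h1 : ∀ x, ∃ e > 0, ∀ j, (ball x e ∩ F j).Nonempty → x ∈ F j := by
    intro x
    obtain ⟨O, hOx, h⟩ := hO x
    obtain ⟨e, he, heO⟩ := Metric.mem_nhds_iff.mp hOx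
    exact ⟨e, he, fun j hj => h j (hj.mono (inter_subset_inter_left _ heO))⟩
  choose e he hF using h1
  refine ⟨fun j => u j ∩ ⋃ x ∈ F j, ball x (e x / 2), ?_, fun j => inter_subset_left, ?_, ?_⟩
  · intro j
    exact (hu j).inter (isOpen_biUnion fun _ _ => isOpen_ball)
  · intro x
    obtain ⟨j, hj⟩ := hcov x
    exact ⟨j, hFu j hj, mem_biUnion hj (mem_ball_self (half_pos (he x)))⟩
  · intro y T hT
    rcases T.eq_empty_or_nonempty with rfl | hne
    · simp
    have h2 : ∀ j, ∃ x, j ∈ T → x ∈ F j ∧ dist y x < e x / 2 := by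
      intro j
      by_cases hj : j ∈ T
      · obtain ⟨x, hx, hxy⟩ := mem_iUnion₂.mp (hT j hj).2
        exact ⟨x, fun _ => ⟨hx, hxy⟩⟩
      · exact ⟨y, fun h => absurd h hj⟩
    choose x hx using h2
    obtain ⟨J, hJ, hmax⟩ := T.exists_max_image (fun j => e (x j)) hne
    apply hord (x J)
    intro j hj
    apply hF
    refine ⟨x j, ?_, (hx j hj).1⟩
    have a1 := (hx j hj).2
    have a2 := (hx J hJ).2
    have a3 := hmax j hj
    have a4 := dist_triangle_left (x j) (x J) y
    rw [mem_ball]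
    linarith

theorem aux_card {α : Type*} (S : Set α) (m : ℕ)
    (h : ∀ T : Finset α, (T : Set α) ⊆ S → T.card ≤ m) : S.Finite ∧ S.ncard ≤ m := by
  have hf : S.Finite := by
    by_contra hinf
    obtain ⟨T, hT, hc⟩ := Set.Infinite.exists_subset_card_eq hinf (m+1)
    have := h T hT
    omega
  refine ⟨hf, ?_⟩
  rw [Set.ncard_eq_toFinset_card S hf]
  exact h _ (by simp)

/-- the disjoint countable dense sets -/
def auxD (j : ℕ) : Set ℝ := range fun q : ℚ => (q : ℝ) + j * √2

theorem auxD_btwn (j : ℕ) (x y : ℝ) (h : x < y) : ∃ a ∈ auxD j, x < a ∧ a < y := by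
  obtain ⟨q, h1, h2⟩ := exists_rat_btwn (show x - j * √2 < y - j * √2 by linarith)
  exact ⟨q + j * √2, ⟨q, rfl⟩, by linarith, by linarith⟩

theorem auxD_disj (i j : ℕ) (x : ℝ) (hi : x ∈ auxD i) (hj : x ∈ auxD j) : i = j := by
  obtain ⟨p, rfl⟩ := hi
  obtain ⟨q, hq⟩ := hj
  simp only at hq
  by_contra hne
  have hne' : ((i:ℝ) - j) ≠ 0 := sub_ne_zero.mpr (by exact_mod_cast hne)
  refine irrational_sqrt_two ⟨(q - p) / ((i:ℚ) - j), ?_⟩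
  push_cast
  rw [div_eq_iff hne']
  linarith

theorem auxD_countable : (⋃ j, auxD j).Countable :=
  countable_iUnion fun _ => countable_range _

theorem aux_cover (n : ℕ) {X : Type*} [MetricSpace X] [LindelofSpace X]
    (g : X → (Fin (n+1) → ℝ)) (hg : Topology.IsInducing g)
    (hC : ∀ x, ∃ i, g x i ∉ ⋃ j, auxD j) : coveringDimLE X n := by
  classical
  intro U hU hUc
  rcases isEmpty_or_nonempty X with hX | hX
  · exact ⟨∅, by simp, by ext x; exact hX.elim x, by simp, fun x => hX.elim x⟩
  have h1 : ∀ x, ∃ u ∈ U, ∃ r > 0, g ⁻¹' (closedBall (g x) (2 * r)) ⊆ u := by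
    intro x
    have : x ∈ ⋃₀ U := by rw [hUc]; trivial
    obtain ⟨u, hu, hxu⟩ := this
    have h2 := (hU u hu).mem_nhds hxu
    rw [hg.nhds_eq_comap] at h2
    obtain ⟨r, hr, h3⟩ := (Metric.nhds_basis_closedBall.comap g).mem_iff.mp h2
    refine ⟨u, hu, r / 2, half_pos hr, ?_⟩
    rwa [mul_div_cancel₀ _ two_ne_zero]
  choose u hu r hr hsub using h1
  obtain ⟨s, hs, hsc⟩ := countable_cover_nhds (U := fun x => g ⁻¹' (ball (g x) (r x))) (fun x =>
    (isOpen_ball.preimage hg.continuous).mem_nhds (mem_ball_self (hr x)))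
  have hsne : s.Nonempty := by
    obtain ⟨x⟩ := hX
    have : x ∈ ⋃ x ∈ s, g ⁻¹' (ball (g x) (r x)) := by rw [hsc]; trivial
    obtain ⟨y, hy, _⟩ := mem_iUnion₂.mp this
    exact ⟨y, hy⟩
  obtain ⟨c, rfl⟩ := hs.exists_eq_range hsne
  choose a haD ha1 ha2 using fun j (i : Fin (n+1)) =>
    auxD_btwn j (g (c j) i - 2 * r (c j)) (g (c j) i - r (c j)) (by linarith [hr (c j)])
  choose b hbD hb1 hb2 using fun j (i : Fin (n+1)) =>
    auxD_btwn j (g (c j) i + r (c j)) (g (c j) i + 2 * r (c j)) (by linarith [hr (c j)])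
  have hgi : ∀ i, Continuous fun x => g x i := fun i => (continuous_apply i).comp hg.continuous
  let Ob : ℕ → Set X := fun j => {x | ∀ i, a j i < g x i ∧ g x i < b j i}
  let Cb : ℕ → Set X := fun j => {x | ∀ i, a j i ≤ g x i ∧ g x i ≤ b j i}
  have hOb : ∀ j, IsOpen (Ob j) := by
    intro j
    have : Ob j = ⋂ i, {x | a j i < g x i ∧ g x i < b j i} := by ext; simp [Ob]
    rw [this]
    exact isOpen_iInter_of_finite fun i =>
      (isOpen_lt continuous_const (hgi i)).inter (isOpen_lt (hgi i) continuous_const)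
  have hCb : ∀ j, IsClosed (Cb j) := by
    intro j
    have : Cb j = ⋂ i, {x | a j i ≤ g x i ∧ g x i ≤ b j i} := by ext; simp [Cb]
    rw [this]
    exact isClosed_iInter fun i =>
      (isClosed_le continuous_const (hgi i)).inter (isClosed_le (hgi i) continuous_const)
  have hOC : ∀ j, Ob j ⊆ Cb j := fun j x hx i => ⟨(hx i).1.le, (hx i).2.le⟩
  have hCu : ∀ j, Cb j ⊆ u (c j) := by
    intro j x hx
    apply hsub
    rw [mem_preimage, mem_closedBall, dist_pi_le_iff (by linarith [hr (c j)])]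
    intro i
    rw [Real.dist_eq, abs_le]
    have := hx i
    constructor <;> linarith [ha1 j i, hb2 j i]
  have hOcov : ∀ x, ∃ j, x ∈ Ob j := by
    intro x
    have : x ∈ ⋃ y ∈ range c, g ⁻¹' (ball (g y) (r y)) := by rw [hsc]; trivial
    obtain ⟨_, ⟨j, rfl⟩, hj⟩ := mem_iUnion₂.mp this
    refine ⟨j, fun i => ?_⟩
    have h2 := (dist_pi_lt_iff (hr (c j))).mp hj i
    rw [Real.dist_eq, abs_lt] at h2
    constructor <;> linarith [ha2 j i, hb1 j i]
  let F : ℕ → Set X := fun j => Cb j \ ⋃ i ∈ Iio j, Ob i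
  have hFcl : ∀ j, IsClosed (F j) := fun j =>
    (hCb j).sdiff (isOpen_biUnion fun i _ => hOb i)
  have hFnot : ∀ j x, x ∈ F j → ∀ i < j, x ∉ Ob i := by
    intro j x hx i hi h
    exact hx.2 (mem_biUnion hi h)
  obtain ⟨v, hvo, hvu, hvc, hvord⟩ := aux_swell F (fun j => u (c j)) (fun j => hU _ (hu _))
    (fun j => diff_subset.trans (hCu j)) (by
      intro x
      refine ⟨Nat.find (hOcov x), hOC _ (Nat.find_spec (hOcov x)), ?_⟩
      intro h
      obtain ⟨i, hi, hxi⟩ := mem_iUnion₂.mp h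
      exact Nat.find_min (hOcov x) hi hxi)
    (by
      intro x
      obtain ⟨m, hm⟩ := hOcov x
      let G : Finset ℕ := (Finset.range (m+1)).filter fun j => x ∉ F j
      refine ⟨Ob m ∩ ⋂ j ∈ G, (F j)ᶜ, ?_, ?_⟩
      · refine Filter.inter_mem ((hOb m).mem_nhds hm) ?_
        rw [Filter.biInter_finset_mem]
        intro j hj
        exact (hFcl j).isOpen_compl.mem_nhds (Finset.mem_filter.mp hj).2
      · rintro j ⟨y, ⟨hy1, hy2⟩, hy3⟩
        by_contra hx
        have hjm : j ≤ m := by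
          by_contra hlt
          exact hFnot j y hy3 m (not_le.mp hlt) hy1
        have hjG : j ∈ G := Finset.mem_filter.mpr ⟨Finset.mem_range.mpr (by omega), hx⟩
        exact (mem_iInter₂.mp hy2 j hjG) hy3)
    (n+1) (by
      intro x T hT
      rcases T.eq_empty_or_nonempty with rfl | hne
      · simp
      have hbd : ∀ j ∈ T.erase (T.max' hne), ∃ i, g x i ∈ auxD j := by
        intro j hj
        have hjT := Finset.mem_of_mem_erase hj
        have hlt : j < T.max' hne :=
          lt_of_le_of_ne (T.le_max' j hjT) (Finset.ne_of_mem_erase hj)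
        have h2 := hFnot _ x (hT _ (T.max'_mem hne)) j hlt
        have h3 := (hT j hjT).1
        by_contra hcon
        push Not at hcon
        refine h2 fun i => ⟨lt_of_le_of_ne (h3 i).1 ?_, lt_of_le_of_ne (h3 i).2 ?_⟩
        · intro h; exact hcon i (h ▸ haD j i)
        · intro h; exact hcon i (h ▸ hbD j i)
      choose! i hi using hbd
      obtain ⟨i0, hi0⟩ := hC x
      have hcard : (T.erase (T.max' hne)).card ≤ (Finset.univ.erase i0).card := by
        refine Finset.card_le_card_of_injOn i ?_ ?_
        · intro j hj
          refine Finset.mem_coe.mpr (Finset.mem_erase.mpr ⟨?_, Finset.mem_univ _⟩)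
          intro h
          exact hi0 (mem_iUnion.mpr ⟨j, h ▸ hi j hj⟩)
        · intro j hj k hk hjk
          have := hi k hk
          rw [← hjk] at this
          exact auxD_disj _ _ _ (hi j hj) this
      rw [Finset.card_erase_of_mem (T.max'_mem hne), Finset.card_erase_of_mem (Finset.mem_univ _),
        Finset.card_univ, Fintype.card_fin] at hcard
      omega)
  refine ⟨range v, ?_, ?_, ?_, ?_⟩
  · rintro _ ⟨j, rfl⟩; exact hvo j
  · refine eq_univ_of_forall fun x => ?_
    obtain ⟨j, hj⟩ := hvc x
    exact ⟨v j, ⟨j, rfl⟩, hj⟩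
  · rintro _ ⟨j, rfl⟩; exact ⟨_, hu (c j), hvu j⟩
  · intro x
    apply aux_card
    intro T hT
    have hch : ∀ w ∈ T, ∃ j, v j = w := fun w hw => (hT hw).1
    choose! k hk using hch
    have hinj : Set.InjOn k T := by
      intro w hw w' hw' h
      rw [← hk w hw, ← hk w' hw', h]
    rw [← Finset.card_image_of_injOn hinj]
    apply hvord x
    intro j hj
    obtain ⟨w, hw, rfl⟩ := Finset.mem_image.mp hj
    rw [hk w hw]
    exact (hT hw).2

theorem aux_cube_emb (m : ℕ) :
    Topology.IsEmbedding (fun x : Cube m => (x.1 : EuclideanSpace ℝ (Fin m))) :=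
  (Topology.IsEmbedding.subtypeVal :
    Topology.IsEmbedding (Subtype.val :
      {x : EuclideanSpace ℝ (Fin m) // ∀ i, x i ∈ Set.Icc (0:ℝ) 1} → EuclideanSpace ℝ (Fin m)))

theorem aux_forward (n : ℕ) (A V : Set (Cube (n+1))) (hV : IsOpen V) (hne : V.Nonempty)
    (hVA : V ⊆ A) (hX : coveringDimLE ↥A n) : False := by
  have hemb := aux_cube_emb (n+1)
  obtain ⟨O', hO', rfl⟩ := hemb.isInducing.isOpen_iff.mp hV
  let O : Set (EuclideanSpace ℝ (Fin (n+1))) := {x | ∀ i, x i ∈ Ioo (0:ℝ) 1} ∩ O'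
  have hco : ∀ i, Continuous fun x : EuclideanSpace ℝ (Fin (n+1)) => x i := fun i => by fun_prop
  have hO : IsOpen O := by
    refine IsOpen.inter ?_ hO'
    have : {x : EuclideanSpace ℝ (Fin (n+1)) | ∀ i, x i ∈ Ioo (0:ℝ) 1} =
        ⋂ i, (fun x : EuclideanSpace ℝ (Fin (n+1)) => x i) ⁻¹' Ioo 0 1 := by ext; simp
    rw [this]
    exact isOpen_iInter_of_finite fun i => isOpen_Ioo.preimage (hco i)
  have hOne : O.Nonempty := by
    obtain ⟨x0, hx0⟩ := hne
    let h : EuclideanSpace ℝ (Fin (n+1)) := WithLp.toLp 2 (fun _ => (1/2 : ℝ))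
    have hc : Continuous fun t : ℝ => x0.1 + t • (h - x0.1) := by fun_prop
    have h1 : (fun t : ℝ => x0.1 + t • (h - x0.1)) ⁻¹' O' ∈ nhds (0:ℝ) := by
      apply hc.continuousAt.preimage_mem_nhds
      apply hO'.mem_nhds
      simpa using hx0
    obtain ⟨e, he, h2⟩ := Metric.mem_nhds_iff.mp h1
    have ht0 : 0 < min (e / 2) (1 / 2) := by positivity
    have ht1 : min (e / 2) (1 / 2) ≤ 1 / 2 := min_le_right _ _
    have ht2 : min (e / 2) (1 / 2) ≤ e / 2 := min_le_left _ _
    generalize min (e / 2) (1 / 2) = t at *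
    refine ⟨x0.1 + t • (h - x0.1), ?_, ?_⟩
    · intro i
      have h3 := x0.2 i
      have h4 : (x0.1 + t • (h - x0.1)) i = x0.1 i + t * (1/2 - x0.1 i) := by
        simp [h]
      rw [h4]
      constructor
      · nlinarith [h3.1, h3.2]
      · nlinarith [h3.1, h3.2]
    · apply h2
      rw [mem_ball, dist_zero_right, Real.norm_of_nonneg ht0.le]
      linarith
  have hin : ∀ x : O, ∀ i, x.1 i ∈ Icc (0:ℝ) 1 := fun x i => Ioo_subset_Icc_self (x.2.1 i)
  let g : O → A := fun x => ⟨⟨x.1, hin x⟩, hVA x.2.2⟩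
  refine aux_cov n (by simp) A hX (fun a => a.1.1)
    (hemb.continuous.comp continuous_subtype_val) O hO hOne g ?_ (fun _ => rfl)
  refine Continuous.subtype_mk ?_ _
  exact hemb.isInducing.continuous_iff.mpr continuous_subtype_val

theorem aux_backward (n : ℕ) (A : Set (Cube (n+1)))
    (hA : ∀ V : Set (Cube (n+1)), IsOpen V → V.Nonempty → ¬ V ⊆ A) : coveringDimLE ↥A n := by
  let k : Cube (n+1) → (Fin (n+1) → ℝ) := fun x => WithLp.ofLp x.1
  have hk : Topology.IsEmbedding k :=
    (PiLp.homeomorph 2 (fun _ : Fin (n+1) => ℝ)).isEmbedding.comp (aux_cube_emb (n+1))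
  have hD : Dense (k '' A)ᶜ := by
    rw [dense_iff_inter_open]
    intro W hW hWne
    by_contra hcon
    have hsub : W ⊆ k '' A := by
      intro x hx
      by_contra h
      exact hcon ⟨x, hx, h⟩
    refine hA (k ⁻¹' W) (hW.preimage hk.continuous) ?_ ?_
    · obtain ⟨x, hx⟩ := hWne
      obtain ⟨a, ha, rfl⟩ := hsub hx
      exact ⟨a, hx⟩
    · intro x hx
      obtain ⟨a, ha, h⟩ := hsub hx
      rwa [← hk.injective h]
  have hcount : (Set.pi univ fun _ : Fin (n+1) => ⋃ j, auxD j).Countable :=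
    Set.countable_univ_pi fun _ => auxD_countable
  have hcne : (Set.pi univ fun _ : Fin (n+1) => ⋃ j, auxD j).Nonempty :=
    ⟨fun _ => 0, fun _ _ => mem_iUnion.mpr ⟨0, 0, by simp⟩⟩
  obtain ⟨q, hq⟩ := hcount.exists_eq_range hcne
  obtain ⟨φ, hφ, hφq⟩ := aux_homeo _ hD q
  have hL : LipschitzWith (1/2) φ := LipschitzWith.of_dist_le_mul (by
    intro x y; simpa using hφ x y)
  have hanti : AntilipschitzWith 2 (fun x => x + φ x) := by
    refine AntilipschitzWith.of_le_mul_dist fun x y => ?_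
    have h1 := hφ x y
    have h2 : dist x y ≤ dist (x + φ x) (y + φ y) + dist (φ x) (φ y) := by
      simp only [dist_eq_norm]
      have : x - y = (x + φ x - (y + φ y)) - (φ x - φ y) := by abel
      rw [this]
      exact norm_sub_le _ _
    push_cast
    linarith
  have hind : Topology.IsInducing (fun x => x + φ x) :=
    (hanti.isUniformInducing (uniformContinuous_id.add hL.uniformContinuous)).isInducing
  have : SecondCountableTopology (Cube (n+1)) := hk.secondCountableTopology
  refine aux_cover n (fun a : A => k a + φ (k a))
    (hind.comp (hk.isInducing.comp Topology.IsInducing.subtypeVal)) ?_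
  intro a
  by_contra hcon
  push Not at hcon
  have h1 : (k a + φ (k a)) ∈ range q := hq ▸ fun i _ => hcon i
  obtain ⟨m, hm⟩ := h1
  obtain ⟨d, hd, hdq⟩ := hφq m
  have h2 : d = k a := hanti.injective (hdq.trans hm)
  exact hd (h2 ▸ ⟨a, a.2, rfl⟩)

theorem stmt0 (n : ℕ) (B : Set (Set (Cube (n+1)))) (hB : B.Countable)
    (hbase : TopologicalSpace.IsTopologicalBasis B) (hne : ∀ V ∈ B, V.Nonempty)
    (A : Set (Cube (n+1))) :
    coveringDimLE ↥A n ↔ ∀ V ∈ B, ¬ V ⊆ A := by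
  constructor
  · intro hX V hV hVA
    exact aux_forward n A V (hbase.isOpen hV) (hne V hV) hVA hX
  · intro h
    apply aux_backward
    rintro V hV ⟨x, hx⟩ hVA
    obtain ⟨W, hW, _, hWV⟩ := hbase.exists_subset_of_mem_open hx hV
    exact h W hW (hWV.trans hVA)
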